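/- Let X be a finite nonempty set and let E : X → { positive definite density matrices on ℂ^d }. Then the minimax inequality min over probability distributions μ on X of max_{x∈X} S(E(x) ‖ ρ_μ) ≤ max over probability distributions λ on X of Σ_{x∈X} λ(x)·S(E(x) ‖ ρ_λ) holds; that is, inf_μ sup_x S(E(x)‖ρ_μ) ≤ T(E), where ρ_μ = Σ_{x∈X} μ(x)·E(x) and T(E) = sup_λ Σ_x λ(x)·S(E(x)‖ρ_λ). -/

import Mathlib

open Matrix
open scoped ComplexOrder

/-- Matrix logarithm: `Real.log` applied to the eigenvalues via the continuous
functional calculus. -/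
noncomputable def matLog {n : Type*} [Fintype n] [DecidableEq n]
    (ρ : Matrix n n ℂ) : Matrix n n ℂ :=
  cfc Real.log ρ

/-- Quantum relative entropy `S(ρ‖σ) = Re (tr (ρ (log ρ - log σ)))`. -/
noncomputable def qRelEnt {n : Type*} [Fintype n] [DecidableEq n]
    (ρ σ : Matrix n n ℂ) : ℝ :=
  (Matrix.trace (ρ * (matLog ρ - matLog σ))).re

/-- A probability distribution on a finite set. -/
def IsProbVec {X : Type*} [Fintype X] (μ : X → ℝ) : Prop :=
  (∀ x, 0 ≤ μ x) ∧ ∑ x, μ x = 1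

section RelativeEntropy

variable {n : Type*} [Fintype n] [DecidableEq n]

/-- The trace of a product of functions of two Hermitian matrices, expanded over pairs of
eigenvalues; the weights do not depend on the functions. -/
lemma Matrix.IsHermitian.trace_cfc_mul_cfc {A B : Matrix n n ℂ} (hA : A.IsHermitian)
    (hB : B.IsHermitian) (f g : ℝ → ℝ) :
    (cfc f A * cfc g B).trace.re = ∑ i, ∑ j, f (hA.eigenvalues i) * g (hB.eigenvalues j) *
      Complex.normSq ((star (hA.eigenvectorUnitary : Matrix n n ℂ) *
        (hB.eigenvectorUnitary : Matrix n n ℂ)) i j) := by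
  rw [hA.cfc_eq, hB.cfc_eq, Matrix.IsHermitian.cfc, Matrix.IsHermitian.cfc,
    Unitary.conjStarAlgAut_apply, Unitary.conjStarAlgAut_apply]
  set U : Matrix n n ℂ := (hA.eigenvectorUnitary : Matrix n n ℂ)
  set V : Matrix n n ℂ := (hB.eigenvectorUnitary : Matrix n n ℂ)
  set F : Matrix n n ℂ := diagonal (RCLike.ofReal ∘ f ∘ hA.eigenvalues) with hF
  set G : Matrix n n ℂ := diagonal (RCLike.ofReal ∘ g ∘ hB.eigenvalues) with hG
  have hcycle : (U * F * star U * (V * G * star V)).trace =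
      (F * (star U * V) * G * star (star U * V)).trace := by
    rw [show U * F * star U * (V * G * star V) = U * (F * star U * V * G * star V) by
      simp only [mul_assoc], trace_mul_comm]
    simp [mul_assoc]
  rw [hcycle, trace, Complex.re_sum]
  refine Finset.sum_congr rfl fun i _ ↦ ?_
  rw [diag_apply, mul_apply, Complex.re_sum]
  refine Finset.sum_congr rfl fun j _ ↦ ?_
  rw [hF, hG, mul_diagonal, diagonal_mul, star_apply, Complex.normSq_apply]
  simp
  ring

/-- **Klein's inequality**. -/
lemma trace_re_sub_trace_re_le_qRelEnt {ρ σ : Matrix n n ℂ} (hρ : ρ.PosDef) (hσ : σ.PosDef) :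
    ρ.trace.re - σ.trace.re ≤ qRelEnt ρ σ := by
  have hcont (f : ℝ → ℝ) : ContinuousOn f (spectrum ℝ ρ) :=
    ρ.finite_real_spectrum.continuousOn f
  have key := hρ.isHermitian.trace_cfc_mul_cfc hσ.isHermitian
  have hidρ : cfc (fun x : ℝ ↦ x) ρ = ρ := cfc_id' ℝ ρ hρ.isHermitian.isSelfAdjoint
  have hidσ : cfc (fun x : ℝ ↦ x) σ = σ := cfc_id' ℝ σ hσ.isHermitian.isSelfAdjoint
  have honeρ : cfc (fun _ : ℝ ↦ (1 : ℝ)) ρ = 1 :=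
    cfc_const_one ℝ ρ hρ.isHermitian.isSelfAdjoint
  have honeσ : cfc (fun _ : ℝ ↦ (1 : ℝ)) σ = 1 :=
    cfc_const_one ℝ σ hσ.isHermitian.isSelfAdjoint
  have hmul : cfc (fun x : ℝ ↦ x * Real.log x) ρ = ρ * matLog ρ := by
    rw [cfc_mul (fun x : ℝ ↦ x) Real.log ρ (hcont _) (hcont _), hidρ, matLog]
  have h₁ := key (fun x ↦ x * Real.log x) (fun _ ↦ 1)
  have h₂ := key (fun x ↦ x) Real.log
  have h₃ := key (fun x ↦ x) (fun _ ↦ 1)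
  have h₄ := key (fun _ ↦ 1) (fun x ↦ x)
  rw [hmul, honeσ, mul_one] at h₁
  rw [hidρ] at h₂
  rw [hidρ, honeσ, mul_one] at h₃
  rw [honeρ, hidσ, one_mul] at h₄
  rw [qRelEnt, mul_sub, trace_sub, Complex.sub_re, h₁, h₃, h₄, matLog, h₂,
    ← Finset.sum_sub_distrib, ← Finset.sum_sub_distrib]
  refine Finset.sum_le_sum fun i _ ↦ ?_
  rw [← Finset.sum_sub_distrib, ← Finset.sum_sub_distrib]
  refine Finset.sum_le_sum fun j _ ↦ ?_
  have hp := hρ.eigenvalues_pos i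
  have hq := hσ.eigenvalues_pos j
  set p := hρ.isHermitian.eigenvalues i
  set q := hσ.isHermitian.eigenvalues j
  rw [← sub_mul, ← sub_mul]
  refine mul_le_mul_of_nonneg_right ?_ (Complex.normSq_nonneg _)
  have hlog : Real.log q - Real.log p ≤ q / p - 1 := by
    rw [← Real.log_div hq.ne' hp.ne']
    exact Real.log_le_sub_one_of_pos (div_pos hq hp)
  have hscaled := mul_le_mul_of_nonneg_left hlog hp.le
  have hcancel : p * (q / p - 1) = q - p := by field_simp
  linarith

/-- The quantum relative entropy of density matrices is nonnegative. -/
lemma qRelEnt_nonneg {ρ σ : Matrix n n ℂ} (hρ : ρ.PosDef) (hσ : σ.PosDef)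
    (htr : ρ.trace = σ.trace) : 0 ≤ qRelEnt ρ σ := by
  simpa [htr] using trace_re_sub_trace_re_le_qRelEnt hρ hσ

open scoped Matrix.Norms.L2Operator in
/-- The matrix logarithm is continuous on positive definite matrices. -/
lemma ContinuousOn.matLog {Y : Type*} [TopologicalSpace Y] {s : Set Y} {a : Y → Matrix n n ℂ}
    (ha : ContinuousOn a s) (hpos : ∀ y ∈ s, (a y).PosDef) :
    ContinuousOn (fun y ↦ matLog (a y)) s := by
  refine ContinuousOn.cfc_of_mem_nhdsSet (s := Set.Ioi 0) Real.log ?_ ha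
    (fun y hy ↦ (hpos y hy).isHermitian.isSelfAdjoint)
    (Real.continuousOn_log.mono fun x hx ↦ ne_of_gt hx)
  refine isOpen_Ioi.mem_nhdsSet.mpr (Set.iUnion₂_subset fun y hy x hx ↦ ?_)
  rw [(hpos y hy).isHermitian.spectrum_real_eq_range_eigenvalues] at hx
  obtain ⟨i, rfl⟩ := hx
  exact (hpos y hy).eigenvalues_pos i

lemma ContinuousOn.qRelEnt {Y : Type*} [TopologicalSpace Y] {s : Set Y} {a : Y → Matrix n n ℂ}
    (ha : ContinuousOn a s) (hpos : ∀ y ∈ s, (a y).PosDef) (ρ : Matrix n n ℂ) :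
    ContinuousOn (fun y ↦ qRelEnt ρ (a y)) s := by
  have hlog := ha.matLog hpos
  have htrace : Continuous fun M : Matrix n n ℂ ↦ (ρ * (_root_.matLog ρ - M)).trace.re := by
    fun_prop
  exact htrace.comp_continuousOn hlog

end RelativeEntropy

section Ensemble

variable {n X : Type*} [Fintype X]

lemma isProbVec_iff_mem_stdSimplex {l : X → ℝ} : IsProbVec l ↔ l ∈ stdSimplex ℝ X :=
  Iff.rfl

lemma IsProbVec.posDef_sum_smul {E : X → Matrix n n ℂ} (hpd : ∀ x, (E x).PosDef) {l : X → ℝ}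
    (hl : IsProbVec l) : (∑ x, l x • E x).PosDef := by
  classical
  obtain ⟨x, hx⟩ : ∃ x, 0 < l x := by
    by_contra! h
    have := Finset.sum_nonpos fun x (_ : x ∈ Finset.univ) ↦ h x
    linarith [hl.2]
  rw [← Finset.add_sum_erase _ _ (Finset.mem_univ x)]
  exact ((hpd x).smul hx).add_posSemidef
    (posSemidef_sum _ fun y _ ↦ (hpd y).posSemidef.smul (hl.1 y))

variable [Fintype n]

lemma IsProbVec.trace_sum_smul {E : X → Matrix n n ℂ} (htr : ∀ x, (E x).trace = 1) {l : X → ℝ}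
    (hl : IsProbVec l) : (∑ x, l x • E x).trace = 1 := by
  simp only [trace_sum, trace_smul, htr, Complex.real_smul, mul_one]
  exact_mod_cast hl.2

variable [DecidableEq n]

/-- **Donald's identity**. -/
lemma sum_mul_qRelEnt_eq_add (E : X → Matrix n n ℂ) (l : X → ℝ) (σ : Matrix n n ℂ) :
    ∑ x, l x * qRelEnt (E x) σ =
      ∑ x, l x * qRelEnt (E x) (∑ y, l y • E y) + qRelEnt (∑ y, l y • E y) σ := by
  set ρ := ∑ y, l y • E y with hρ
  have hlin : qRelEnt ρ σ = ∑ x, l x * ((E x) * (matLog ρ - matLog σ)).trace.re := by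
    rw [qRelEnt]
    conv_lhs => rw [hρ, Finset.sum_mul, ← hρ]
    simp [trace_sum, trace_smul]
  rw [hlin, ← Finset.sum_add_distrib]
  refine Finset.sum_congr rfl fun x _ ↦ ?_
  simp only [qRelEnt, mul_sub, trace_sub, Complex.sub_re]
  ring

/-- If `l` maximizes the average divergence `∑ x, l x * S(E x ‖ ρ_l)`, then every `S(E y ‖ ρ_l)`
is bounded by the maximum. -/
lemma IsProbVec.qRelEnt_le_of_isMaxOn {E : X → Matrix n n ℂ} (hpd : ∀ x, (E x).PosDef)
    (htr : ∀ x, (E x).trace = 1) {l : X → ℝ} (hl : IsProbVec l)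
    (hmax : IsMaxOn (fun l : X → ℝ ↦ ∑ x, l x * qRelEnt (E x) (∑ y, l y • E y))
      (stdSimplex ℝ X) l) (y : X) :
    qRelEnt (E y) (∑ z, l z • E z) ≤ ∑ x, l x * qRelEnt (E x) (∑ z, l z • E z) := by
  classical
  set T := ∑ x, l x * qRelEnt (E x) (∑ z, l z • E z) with hT
  let m : ℝ → X → ℝ := fun t ↦ (1 - t) • l + t • Pi.single y 1
  have hm (t : ℝ) (ht : t ∈ Set.Icc (0 : ℝ) 1) : IsProbVec (m t) :=
    convex_stdSimplex ℝ X hl (single_mem_stdSimplex ℝ y) (sub_nonneg.mpr ht.2) ht.1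
      (sub_add_cancel 1 t)
  have hbound (t : ℝ) (ht : t ∈ Set.Ioc (0 : ℝ) 1) :
      qRelEnt (E y) (∑ z, m t z • E z) ≤ T := by
    have hmt := hm t ⟨ht.1.le, ht.2⟩
    set σ := ∑ z, m t z • E z with hσ
    have hexpand : ∑ x, m t x * qRelEnt (E x) σ =
        (1 - t) * ∑ x, l x * qRelEnt (E x) σ + t * qRelEnt (E y) σ := by
      simp [m, add_mul, Finset.sum_add_distrib, Finset.mul_sum, mul_assoc, Pi.single_apply]
    have hle : ∑ x, m t x * qRelEnt (E x) σ ≤ T := hmax (isProbVec_iff_mem_stdSimplex.mp hmt)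
    have hklein : 0 ≤ qRelEnt (∑ z, l z • E z) σ :=
      qRelEnt_nonneg (hl.posDef_sum_smul hpd) (hmt.posDef_sum_smul hpd)
        ((hl.trace_sum_smul htr).trans (hmt.trace_sum_smul htr).symm)
    rw [hexpand, sum_mul_qRelEnt_eq_add, ← hT] at hle
    have hscaled := mul_nonneg (sub_nonneg.mpr ht.2) hklein
    refine le_of_mul_le_mul_left ?_ ht.1
    linarith
  have hcont : ContinuousOn (fun t ↦ qRelEnt (E y) (∑ z, m t z • E z)) (Set.Icc 0 1) := by
    refine ContinuousOn.qRelEnt (Continuous.continuousOn ?_)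
      (fun t ht ↦ (hm t ht).posDef_sum_smul hpd) _
    simp only [m, Pi.add_apply, Pi.smul_apply]
    fun_prop
  have hlim := (hcont 0 (by simp)).mono Set.Ioc_subset_Icc_self
  have hm₀ : m 0 = l := by simp [m]
  have hne : (nhdsWithin (0 : ℝ) (Set.Ioc 0 1)).NeBot := by
    rw [nhdsWithin_Ioc_eq_nhdsGT one_pos]
    infer_instance
  rw [← hm₀]
  exact le_of_tendsto hlim (Filter.eventually_of_mem self_mem_nhdsWithin hbound)

end Ensemble

/-- Minimax inequality: `inf_μ sup_x S(E(x)‖ρ_μ) ≤ T(E)`. -/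
theorem stmt_7 {d : ℕ} {X : Type*} [Fintype X] [Nonempty X]
    (E : X → Matrix (Fin d) (Fin d) ℂ)
    (hpd : ∀ x, (E x).PosDef) (htr : ∀ x, (E x).trace = 1) :
    (⨅ μ : {l : X → ℝ // IsProbVec l}, ⨆ x, qRelEnt (E x) (∑ y, μ.1 y • E y)) ≤
      ⨆ lam : {l : X → ℝ // IsProbVec l},
        ∑ x, lam.1 x * qRelEnt (E x) (∑ y, lam.1 y • E y) := by
  classical
  have hcont : ContinuousOn (fun l : X → ℝ ↦ ∑ x, l x * qRelEnt (E x) (∑ y, l y • E y))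
      (stdSimplex ℝ X) := by
    refine continuousOn_finsetSum _ fun x _ ↦ (continuous_apply x).continuousOn.mul ?_
    refine ContinuousOn.qRelEnt (Continuous.continuousOn ?_)
      (fun l hl ↦ (isProbVec_iff_mem_stdSimplex.mpr hl).posDef_sum_smul hpd) _
    fun_prop
  obtain ⟨l, hl, hmax⟩ := (isCompact_stdSimplex ℝ X).exists_isMaxOn
    ⟨_, single_mem_stdSimplex ℝ (Classical.arbitrary X)⟩ hcont
  have hbelow : BddBelow (Set.range fun μ : {l : X → ℝ // IsProbVec l} ↦
      ⨆ x, qRelEnt (E x) (∑ y, μ.1 y • E y)) := by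
    refine ⟨0, ?_⟩
    rintro _ ⟨μ, rfl⟩
    exact Real.iSup_nonneg fun x ↦ qRelEnt_nonneg (hpd x) (μ.2.posDef_sum_smul hpd)
      ((htr x).trans (μ.2.trace_sum_smul htr).symm)
  have habove : BddAbove (Set.range fun lam : {l : X → ℝ // IsProbVec l} ↦
      ∑ x, lam.1 x * qRelEnt (E x) (∑ y, lam.1 y • E y)) := by
    refine ⟨∑ x, l x * qRelEnt (E x) (∑ y, l y • E y), ?_⟩
    rintro _ ⟨μ, rfl⟩
    exact hmax μ.2
  refine (ciInf_le hbelow ⟨l, hl⟩).trans (le_trans ?_ (le_ciSup habove ⟨l, hl⟩))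
  exact ciSup_le fun y ↦ IsProbVec.qRelEnt_le_of_isMaxOn hpd htr hl hmax y
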